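/- arXiv:2101.03951 — 10 statements merged into one kernel-verified Lean document; each statement's English description precedes it below -/
import Mathlib

section
/- The extended bracket [(ξ,η),(ξ′,η′)] := ([ξ,ξ′] + η▷ξ′ − η′▷ξ + Φ(η,η′), κ(η,η′) + η◁ξ′ − η′◁ξ) makes the direct sum 𝔤 ⊕ 𝔥 into a Lie algebra over 𝕜 (i.e., the bracket is bilinear, alternating, and satisfies the Jacobi identity) if and only if the extended-structure conditions (E1)–(E8) hold. -/
/-- A bracket `B` on a `𝕜`-module `M` makes it a Lie algebra iff it is bilinear,
alternating, and satisfies the Jacobi identity. -/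
def IsLieBracketOn (𝕜 : Type*) {M : Type*} [Field 𝕜] [AddCommGroup M] [Module 𝕜 M]
    (B : M → M → M) : Prop :=
  (∀ (a : 𝕜) (x y z : M), B (a • x + y) z = a • B x z + B y z) ∧
  (∀ (a : 𝕜) (x y z : M), B x (a • y + z) = a • B x y + B x z) ∧
  (∀ x : M, B x x = 0) ∧
  (∀ x y z : M, B x (B y z) + B y (B z x) + B z (B x y) = 0)

/-- The extended-structure conditions (E1)–(E8). -/
def ExtStructConds {𝕜 G H : Type*} [Field 𝕜] [LieRing G] [LieAlgebra 𝕜 G]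
    [AddCommGroup H] [Module 𝕜 H]
    (tr : H →ₗ[𝕜] G →ₗ[𝕜] G) (tl : H →ₗ[𝕜] G →ₗ[𝕜] H)
    (Φ : H →ₗ[𝕜] H →ₗ[𝕜] G) (κ : H →ₗ[𝕜] H →ₗ[𝕜] H) : Prop :=
  (∀ η : H, κ η η = 0) ∧
  (∀ η : H, Φ η η = 0) ∧
  (∀ (ξ : G) (η η' : H),
    tl (κ η η') ξ = κ η (tl η' ξ) - κ η' (tl η ξ) + tl η (tr η' ξ) - tl η' (tr η ξ)) ∧
  (∀ (ξ : G) (η η' : H),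
    tr (κ η η') ξ = ⁅ξ, Φ η η'⁆ + Φ η (tl η' ξ) + Φ (tl η ξ) η'
      + tr η (tr η' ξ) - tr η' (tr η ξ)) ∧
  (∀ (ξ ξ' : G) (η : H),
    tr η ⁅ξ, ξ'⁆ = ⁅ξ, tr η ξ'⁆ - ⁅ξ', tr η ξ⁆ + tr (tl η ξ) ξ' - tr (tl η ξ') ξ) ∧
  (∀ (ξ ξ' : G) (η : H),
    tl η ⁅ξ, ξ'⁆ = tl (tl η ξ) ξ' - tl (tl η ξ') ξ) ∧
  (∀ η η' η'' : H,
    Φ η (κ η' η'') + Φ η' (κ η'' η) + Φ η'' (κ η η')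
      + tr η (Φ η' η'') + tr η' (Φ η'' η) + tr η'' (Φ η η') = 0) ∧
  (∀ η η' η'' : H,
    κ η (κ η' η'') + κ η' (κ η'' η) + κ η'' (κ η η')
      + tl η (Φ η' η'') + tl η' (Φ η'' η) + tl η'' (Φ η η') = 0)

/-- The extended bracket on `G ⊕ H` is a Lie bracket
iff the extended-structure conditions (E1)–(E8) hold. -/
theorem extended_bracket_isLieBracket_iff_extStructConds
    {𝕜 G H : Type*} [Field 𝕜] [LieRing G] [LieAlgebra 𝕜 G]
    [AddCommGroup H] [Module 𝕜 H]
    (tr : H →ₗ[𝕜] G →ₗ[𝕜] G) (tl : H →ₗ[𝕜] G →ₗ[𝕜] H)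
    (Φ : H →ₗ[𝕜] H →ₗ[𝕜] G) (κ : H →ₗ[𝕜] H →ₗ[𝕜] H) :
    IsLieBracketOn 𝕜 (M := G × H) (fun x y =>
      (⁅x.1, y.1⁆ + tr x.2 y.1 - tr y.2 x.1 + Φ x.2 y.2,
        κ x.2 y.2 + tl x.2 y.1 - tl y.2 x.1)) ↔
    ExtStructConds tr tl Φ κ := by
  constructor
  · rintro ⟨-, -, halt, hjac⟩
    refine ⟨fun η => ?_, fun η => ?_, fun ξ η η' => ?_, fun ξ η η' => ?_, fun ξ ξ' η => ?_,
      fun ξ ξ' η => ?_, fun η η' η'' => ?_, fun η η' η'' => ?_⟩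
    · simpa using congrArg Prod.snd (halt (0, η))
    · simpa using congrArg Prod.fst (halt (0, η))
    · have h := congrArg Prod.snd (hjac (0, η) (0, η') (ξ, 0))
      simp at h
      linear_combination (norm := module) -h
    · have h := congrArg Prod.fst (hjac (0, η) (0, η') (ξ, 0))
      have hΦ : Φ (tl η ξ) η' = -Φ η' (tl η ξ) :=
        (LinearMap.IsAlt.neg (fun ζ => by simpa using congrArg Prod.fst (halt (0, ζ))) _ _).symm
      simp at h
      linear_combination (norm := module) -h - hΦ
    · have h := congrArg Prod.fst (hjac (0, η) (ξ, 0) (ξ', 0))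
      simp [-lie_skew] at h
      linear_combination (norm := module) h
    · have h := congrArg Prod.snd (hjac (0, η) (ξ, 0) (ξ', 0))
      simp at h
      linear_combination (norm := module) h
    · have h := congrArg Prod.fst (hjac (0, η) (0, η') (0, η''))
      simp at h
      linear_combination (norm := module) h
    · have h := congrArg Prod.snd (hjac (0, η) (0, η') (0, η''))
      simp at h
      linear_combination (norm := module) h
  · rintro ⟨hκ, hΦ, hκtl, hκtr, htr, htl, hΦjac, hκjac⟩
    have hskew (η η' : H) : Φ η η' = -Φ η' η := (LinearMap.IsAlt.neg hΦ η' η).symm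
    refine ⟨fun a x y z => ?_, fun a x y z => ?_, fun x => ?_, ?_⟩
    · ext <;> simp <;> module
    · ext <;> simp <;> module
    · simp [hκ, hΦ]
    · rintro ⟨a, u⟩ ⟨b, v⟩ ⟨c, w⟩
      ext
      · simp only [Prod.fst_add, Prod.fst_zero, map_add, map_sub, LinearMap.add_apply,
          LinearMap.sub_apply, lie_add, lie_sub]
        linear_combination (norm := module) lie_jacobi a b c + htr b c u + htr c a v + htr a b w
          - hκtr a v w - hκtr b w u - hκtr c u v + hΦjac u v w
          - hskew (tl v a) w - hskew (tl w b) u - hskew (tl u c) v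
      · simp only [Prod.snd_add, Prod.snd_zero, map_add, map_sub, LinearMap.add_apply,
          LinearMap.sub_apply]
        linear_combination (norm := module) htl b c u + htl c a v + htl a b w
          - hκtl a v w - hκtl b w u - hκtl c u v + hκjac u v w
end

section
/- Assume Φ(η,η) = 0 and κ(η,η) = 0 for all η ∈ 𝔥 (so Φ and κ are antisymmetric). Then the Jacobi sum [(ξ,0),[(0,η),(0,η′)]] + [(0,η),[(0,η′),(ξ,0)]] + [(0,η′),[(ξ,0),(0,η)]] for the extended bracket vanishes for all ξ ∈ 𝔤 and η,η′ ∈ 𝔥 if and only if conditions (E3) and (E4) hold for all ξ ∈ 𝔤 and η,η′ ∈ 𝔥. -/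
/-- The extended bracket on `G × H` built from the data `(▷, ◁, Φ, κ)`. -/
def extBracket {𝕜 G H : Type*} [Field 𝕜] [LieRing G] [LieAlgebra 𝕜 G]
    [AddCommGroup H] [Module 𝕜 H]
    (tr : H →ₗ[𝕜] G →ₗ[𝕜] G) (tl : H →ₗ[𝕜] G →ₗ[𝕜] H)
    (Φ : H →ₗ[𝕜] H →ₗ[𝕜] G) (κ : H →ₗ[𝕜] H →ₗ[𝕜] H)
    (x y : G × H) : G × H :=
  (⁅x.1, y.1⁆ + tr x.2 y.1 - tr y.2 x.1 + Φ x.2 y.2,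
    κ x.2 y.2 + tl x.2 y.1 - tl y.2 x.1)

/-- The mixed Jacobi sum of the extended bracket, written out in components. -/
theorem extBracket_mixed_jacobi_sum {𝕜 G H : Type*} [Field 𝕜] [LieRing G] [LieAlgebra 𝕜 G]
    [AddCommGroup H] [Module 𝕜 H]
    (tr : H →ₗ[𝕜] G →ₗ[𝕜] G) (tl : H →ₗ[𝕜] G →ₗ[𝕜] H)
    (Φ : H →ₗ[𝕜] H →ₗ[𝕜] G) (κ : H →ₗ[𝕜] H →ₗ[𝕜] H)
    (hΦ : Φ.IsAlt) (ξ : G) (η η' : H) :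
    extBracket tr tl Φ κ (ξ, 0) (extBracket tr tl Φ κ (0, η) (0, η'))
        + extBracket tr tl Φ κ (0, η) (extBracket tr tl Φ κ (0, η') (ξ, 0))
        + extBracket tr tl Φ κ (0, η') (extBracket tr tl Φ κ (ξ, 0) (0, η)) =
      (⁅ξ, Φ η η'⁆ + Φ η (tl η' ξ) + Φ (tl η ξ) η' + tr η (tr η' ξ) - tr η' (tr η ξ)
          - tr (κ η η') ξ,
        κ η (tl η' ξ) - κ η' (tl η ξ) + tl η (tr η' ξ) - tl η' (tr η ξ)
          - tl (κ η η') ξ) := by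
  rw [← hΦ.neg η' (tl η ξ)]
  ext <;> simp [extBracket] <;> abel

/-- Assuming `Φ` and `κ` are alternating, the Jacobi sum
`[(ξ,0),[(0,η),(0,η′)]] + [(0,η),[(0,η′),(ξ,0)]] + [(0,η′),[(ξ,0),(0,η)]]`
for the extended bracket vanishes for all `ξ ∈ G`, `η, η′ ∈ H` iff
conditions (E3) and (E4) hold. -/
theorem extended_bracket_mixed_jacobi_iff_E3_E4
    {𝕜 G H : Type*} [Field 𝕜] [LieRing G] [LieAlgebra 𝕜 G]
    [AddCommGroup H] [Module 𝕜 H]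
    (tr : H →ₗ[𝕜] G →ₗ[𝕜] G) (tl : H →ₗ[𝕜] G →ₗ[𝕜] H)
    (Φ : H →ₗ[𝕜] H →ₗ[𝕜] G) (κ : H →ₗ[𝕜] H →ₗ[𝕜] H)
    (hΦ : ∀ η : H, Φ η η = 0) (hκ : ∀ η : H, κ η η = 0) :
    (∀ (ξ : G) (η η' : H),
      extBracket tr tl Φ κ (ξ, 0) (extBracket tr tl Φ κ (0, η) (0, η'))
        + extBracket tr tl Φ κ (0, η) (extBracket tr tl Φ κ (0, η') (ξ, 0))
        + extBracket tr tl Φ κ (0, η') (extBracket tr tl Φ κ (ξ, 0) (0, η)) = 0) ↔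
    ((∀ (ξ : G) (η η' : H),
        tl (κ η η') ξ = κ η (tl η' ξ) - κ η' (tl η ξ) + tl η (tr η' ξ) - tl η' (tr η ξ)) ∧
      (∀ (ξ : G) (η η' : H),
        tr (κ η η') ξ = ⁅ξ, Φ η η'⁆ + Φ η (tl η' ξ) + Φ (tl η ξ) η'
          + tr η (tr η' ξ) - tr η' (tr η ξ))) := by
  simp only [extBracket_mixed_jacobi_sum tr tl Φ κ hΦ, Prod.mk_eq_zero, sub_eq_zero]
  exact ⟨fun h => ⟨fun ξ η η' => (h ξ η η').2.symm, fun ξ η η' => (h ξ η η').1.symm⟩,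
    fun h ξ η η' => ⟨(h.2 ξ η η').symm, (h.1 ξ η η').symm⟩⟩
end

section
/- Assume Φ(η,η) = 0 and κ(η,η) = 0 for all η ∈ 𝔥 (so Φ and κ are antisymmetric). Then the Jacobi sum [[(0,η),(0,η′)],(0,η″)] + [[(0,η′),(0,η″)],(0,η)] + [[(0,η″),(0,η)],(0,η′)] for the extended bracket vanishes for all η,η′,η″ ∈ 𝔥 if and only if the two cyclic conditions (E7) and (E8) hold for all η,η′,η″ ∈ 𝔥. -/
/-- Bracketing `[(0, η), (0, η')]` with `(0, η'')`, rewritten by antisymmetry of `Φ` and `κ` so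
that `η''` is the first argument of every map. -/
theorem extBracket_extBracket_zero_fst
    {𝕜 G H : Type*} [Field 𝕜] [LieRing G] [LieAlgebra 𝕜 G]
    [AddCommGroup H] [Module 𝕜 H]
    (tr : H →ₗ[𝕜] G →ₗ[𝕜] G) (tl : H →ₗ[𝕜] G →ₗ[𝕜] H)
    {Φ : H →ₗ[𝕜] H →ₗ[𝕜] G} {κ : H →ₗ[𝕜] H →ₗ[𝕜] H}
    (hΦ : Φ.IsAlt) (hκ : κ.IsAlt) (η η' η'' : H) :
    extBracket tr tl Φ κ (extBracket tr tl Φ κ (0, η) (0, η')) (0, η'') =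
      -(Φ η'' (κ η η') + tr η'' (Φ η η'), κ η'' (κ η η') + tl η'' (Φ η η')) := by
  ext
  · simp [extBracket, ← hΦ.neg η'' (κ η η')]
  · simp [extBracket, ← hκ.neg η'' (κ η η')]
    abel

/-- Assuming `Φ` and `κ` are alternating, the Jacobi sum
`[[(0,η),(0,η′)],(0,η″)] + [[(0,η′),(0,η″)],(0,η)] + [[(0,η″),(0,η)],(0,η′)]`
for the extended bracket vanishes for all `η, η′, η″ ∈ H` iff the cyclic
conditions (E7) and (E8) hold. -/
theorem extended_bracket_h_jacobi_iff_E7_E8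
    {𝕜 G H : Type*} [Field 𝕜] [LieRing G] [LieAlgebra 𝕜 G]
    [AddCommGroup H] [Module 𝕜 H]
    (tr : H →ₗ[𝕜] G →ₗ[𝕜] G) (tl : H →ₗ[𝕜] G →ₗ[𝕜] H)
    (Φ : H →ₗ[𝕜] H →ₗ[𝕜] G) (κ : H →ₗ[𝕜] H →ₗ[𝕜] H)
    (hΦ : ∀ η : H, Φ η η = 0) (hκ : ∀ η : H, κ η η = 0) :
    (∀ η η' η'' : H,
      extBracket tr tl Φ κ (extBracket tr tl Φ κ (0, η) (0, η')) (0, η'')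
        + extBracket tr tl Φ κ (extBracket tr tl Φ κ (0, η') (0, η'')) (0, η)
        + extBracket tr tl Φ κ (extBracket tr tl Φ κ (0, η'') (0, η)) (0, η') = 0) ↔
    ((∀ η η' η'' : H,
        Φ η (κ η' η'') + Φ η' (κ η'' η) + Φ η'' (κ η η')
          + tr η (Φ η' η'') + tr η' (Φ η'' η) + tr η'' (Φ η η') = 0) ∧
      (∀ η η' η'' : H,
        κ η (κ η' η'') + κ η' (κ η'' η) + κ η'' (κ η η')
          + tl η (Φ η' η'') + tl η' (Φ η'' η) + tl η'' (Φ η η') = 0)) := by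
  simp only [extBracket_extBracket_zero_fst tr tl hΦ hκ, ← neg_add, neg_eq_zero, Prod.mk_add_mk,
    Prod.mk_eq_zero, forall_and]
  refine and_congr ?_ ?_ <;>
  · refine forall₃_congr fun η η' η'' => Eq.congr_left ?_
    abel
end

section
/- Let 𝔎 be a Lie algebra over a field 𝕜, let 𝔤 ⊆ 𝔎 be a Lie subalgebra and 𝔥 ⊆ 𝔎 a linear subspace such that 𝔎 = 𝔤 ⊕ 𝔥 as an internal direct sum of vector spaces, with linear projections p_𝔤 : 𝔎 → 𝔤 and p_𝔥 : 𝔎 → 𝔥. Define Φ(η,η′) := p_𝔤[η,η′], κ(η,η′) := p_𝔥[η,η′], η▷ξ := p_𝔤[η,ξ] and η◁ξ := p_𝔥[η,ξ] for ξ ∈ 𝔤, η,η′ ∈ 𝔥. Then these maps satisfy the extended-structure conditions (E1)–(E8), and for all ξ,ξ′ ∈ 𝔤 and η,η′ ∈ 𝔥 one has [ξ + η, ξ′ + η′] = ([ξ,ξ′] + η▷ξ′ − η′▷ξ + Φ(η,η′)) + (κ(η,η′) + η◁ξ′ − η′◁ξ) in 𝔎; in particular the linear isomorphism 𝔤 ⊕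 𝔥 → 𝔎, (ξ,η) ↦ ξ + η, carries the extended bracket to the bracket of 𝔎. -/
/-- **Universal Lemma.** If `K = g ⊕ h` as vector spaces with `g`
a Lie subalgebra and `h` a subspace, with projections `pg`, `ph`, then the
induced maps `Φ(η,η′) := pg ⁅η,η′⁆`, `κ(η,η′) := ph ⁅η,η′⁆`, `η▷ξ := pg ⁅η,ξ⁆`,
`η◁ξ := ph ⁅η,ξ⁆` satisfy the extended-structure conditions (E1)–(E8), and the
bracket of `K` decomposes as the extended bracket. -/
theorem universal_lemma_extended_structure
    {𝕜 K : Type*} [Field 𝕜] [LieRing K] [LieAlgebra 𝕜 K]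
    (g : LieSubalgebra 𝕜 K) (h : Submodule 𝕜 K)
    (pg ph : K →ₗ[𝕜] K)
    (hpg : ∀ x : K, pg x ∈ g) (hph : ∀ x : K, ph x ∈ h)
    (hsum : ∀ x : K, pg x + ph x = x)
    (hg : ∀ x ∈ g, pg x = x) (hh : ∀ x ∈ h, ph x = x) :
    -- (E1)
    (∀ η ∈ h, ph ⁅η, η⁆ = 0) ∧
    -- (E2)
    (∀ η ∈ h, pg ⁅η, η⁆ = 0) ∧
    -- (E3)
    (∀ ξ ∈ g, ∀ η ∈ h, ∀ η' ∈ h,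
      ph ⁅ph ⁅η, η'⁆, ξ⁆ = ph ⁅η, ph ⁅η', ξ⁆⁆ - ph ⁅η', ph ⁅η, ξ⁆⁆
        + ph ⁅η, pg ⁅η', ξ⁆⁆ - ph ⁅η', pg ⁅η, ξ⁆⁆) ∧
    -- (E4)
    (∀ ξ ∈ g, ∀ η ∈ h, ∀ η' ∈ h,
      pg ⁅ph ⁅η, η'⁆, ξ⁆ = ⁅ξ, pg ⁅η, η'⁆⁆ + pg ⁅η, ph ⁅η', ξ⁆⁆ + pg ⁅ph ⁅η, ξ⁆, η'⁆
        + pg ⁅η, pg ⁅η', ξ⁆⁆ - pg ⁅η', pg ⁅η, ξ⁆⁆) ∧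
    -- (E5)
    (∀ ξ ∈ g, ∀ ξ' ∈ g, ∀ η ∈ h,
      pg ⁅η, ⁅ξ, ξ'⁆⁆ = ⁅ξ, pg ⁅η, ξ'⁆⁆ - ⁅ξ', pg ⁅η, ξ⁆⁆
        + pg ⁅ph ⁅η, ξ⁆, ξ'⁆ - pg ⁅ph ⁅η, ξ'⁆, ξ⁆) ∧
    -- (E6)
    (∀ ξ ∈ g, ∀ ξ' ∈ g, ∀ η ∈ h,
      ph ⁅η, ⁅ξ, ξ'⁆⁆ = ph ⁅ph ⁅η, ξ⁆, ξ'⁆ - ph ⁅ph ⁅η, ξ'⁆, ξ⁆) ∧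
    -- (E7)
    (∀ η ∈ h, ∀ η' ∈ h, ∀ η'' ∈ h,
      pg ⁅η, ph ⁅η', η''⁆⁆ + pg ⁅η', ph ⁅η'', η⁆⁆ + pg ⁅η'', ph ⁅η, η'⁆⁆
        + pg ⁅η, pg ⁅η', η''⁆⁆ + pg ⁅η', pg ⁅η'', η⁆⁆ + pg ⁅η'', pg ⁅η, η'⁆⁆ = 0) ∧
    -- (E8)
    (∀ η ∈ h, ∀ η' ∈ h, ∀ η'' ∈ h,
      ph ⁅η, ph ⁅η', η''⁆⁆ + ph ⁅η', ph ⁅η'', η⁆⁆ + ph ⁅η'', ph ⁅η, η'⁆⁆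
        + ph ⁅η, pg ⁅η', η''⁆⁆ + ph ⁅η', pg ⁅η'', η⁆⁆ + ph ⁅η'', pg ⁅η, η'⁆⁆ = 0) ∧
    -- decomposition of the bracket of `K`
    (∀ ξ ∈ g, ∀ ξ' ∈ g, ∀ η ∈ h, ∀ η' ∈ h,
      ⁅ξ + η, ξ' + η'⁆ =
        (⁅ξ, ξ'⁆ + pg ⁅η, ξ'⁆ - pg ⁅η', ξ⁆ + pg ⁅η, η'⁆)
          + (ph ⁅η, η'⁆ + ph ⁅η, ξ'⁆ - ph ⁅η', ξ⁆)) := by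
  have ph_zero : ∀ x ∈ g, ph x = 0 := fun x hx => by simpa [hg x hx] using hsum x
  have split_right (f : K →ₗ[𝕜] K) (a x : K) : f ⁅a, x⁆ = f ⁅a, ph x⁆ + f ⁅a, pg x⁆ := by
    rw [← map_add, ← lie_add, add_comm, hsum]
  have split_left (f : K →ₗ[𝕜] K) (x a : K) : f ⁅x, a⁆ = f ⁅ph x, a⁆ + f ⁅pg x, a⁆ := by
    rw [← map_add, ← add_lie, add_comm, hsum]
  have jacobi (f : K →ₗ[𝕜] K) (a b c : K) : f ⁅⁅a, b⁆, c⁆ = f ⁅a, ⁅b, c⁆⁆ - f ⁅b, ⁅a, c⁆⁆ := by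
    rw [lie_lie, map_sub]
  have cyclic (f : K →ₗ[𝕜] K) (a b c : K) :
      f ⁅a, ph ⁅b, c⁆⁆ + f ⁅b, ph ⁅c, a⁆⁆ + f ⁅c, ph ⁅a, b⁆⁆
        + f ⁅a, pg ⁅b, c⁆⁆ + f ⁅b, pg ⁅c, a⁆⁆ + f ⁅c, pg ⁅a, b⁆⁆ = 0 := by
    have hj := congrArg f (lie_jacobi a b c)
    rw [map_add, map_add, map_zero, split_right f a, split_right f b, split_right f c] at hj
    rw [← hj]
    abel
  refine ⟨by simp, by simp, ?_, ?_, ?_, ?_, fun a _ b _ c _ => cyclic pg a b c,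
    fun a _ b _ c _ => cyclic ph a b c, ?_⟩
  · intro ξ hξ η _ η' _
    have hj := jacobi ph η η' ξ
    rw [split_left, split_right ph η ⁅η', ξ⁆, split_right ph η' ⁅η, ξ⁆,
      ph_zero _ (g.lie_mem (hpg _) hξ), add_zero] at hj
    rw [hj]
    abel
  · intro ξ hξ η _ η' _
    have hj := jacobi pg η η' ξ
    rw [split_left, split_right pg η ⁅η', ξ⁆, split_right pg η' ⁅η, ξ⁆,
      hg _ (g.lie_mem (hpg _) hξ), ← eq_sub_iff_add_eq] at hj
    rw [hj, ← lie_skew ξ, ← lie_skew (ph ⁅η, ξ⁆) η', map_neg]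
    abel
  · intro ξ hξ ξ' hξ' η _
    have hj := congrArg pg (leibniz_lie η ξ ξ')
    rw [map_add, split_left pg ⁅η, ξ⁆, split_right pg ξ,
      hg _ (g.lie_mem (hpg _) hξ'), hg _ (g.lie_mem hξ (hpg _))] at hj
    rw [hj, ← lie_skew ξ', ← lie_skew (ph ⁅η, ξ'⁆) ξ, map_neg]
    abel
  · intro ξ hξ ξ' hξ' η _
    have hj := congrArg ph (leibniz_lie η ξ ξ')
    rw [map_add, split_left ph ⁅η, ξ⁆, split_right ph ξ,
      ph_zero _ (g.lie_mem (hpg _) hξ'), ph_zero _ (g.lie_mem hξ (hpg _))] at hj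
    rw [hj, ← lie_skew (ph ⁅η, ξ'⁆) ξ, map_neg]
    abel
  · intro ξ _ ξ' _ η _ η' _
    calc ⁅ξ + η, ξ' + η'⁆ = ⁅ξ, ξ'⁆ + ⁅η, ξ'⁆ - ⁅η', ξ⁆ + ⁅η, η'⁆ := by
          rw [add_lie, lie_add, lie_add, ← lie_skew ξ η']
          abel
      _ = ⁅ξ, ξ'⁆ + (pg ⁅η, ξ'⁆ + ph ⁅η, ξ'⁆) - (pg ⁅η', ξ⁆ + ph ⁅η', ξ⁆)
            + (pg ⁅η, η'⁆ + ph ⁅η, η'⁆) := by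
          simp only [hsum]
      _ = _ := by abel
end

section
/- Let 𝔤 and 𝔥 be Lie algebras over a field 𝕜, let ▷ : 𝔥 × 𝔤 → 𝔤 be a left Lie-algebra action and ◁ : 𝔥 × 𝔤 → 𝔥 a right Lie-algebra action satisfying the matched pair compatibility conditions (M1) and (M2). Then the matched pair bracket [(ξ,η),(ξ′,η′)] := ([ξ,ξ′] + η▷ξ′ − η′▷ξ, [η,η′] + η◁ξ′ − η′◁ξ) makes the direct sum 𝔤 ⊕ 𝔥 into a Lie algebra over 𝕜. -/
/-- For a matched pair of Lie algebras `(G, H, ▷, ◁)`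
(mutual actions satisfying the compatibility conditions (M1), (M2)), the
matched pair bracket makes `G ⊕ H` into a Lie algebra. -/
theorem matchedPair_bracket_isLieBracket
    {𝕜 G H : Type*} [Field 𝕜] [LieRing G] [LieAlgebra 𝕜 G]
    [LieRing H] [LieAlgebra 𝕜 H]
    (tr : H →ₗ[𝕜] G →ₗ[𝕜] G) (tl : H →ₗ[𝕜] G →ₗ[𝕜] H)
    (h_left : ∀ (η η' : H) (ξ : G), tr ⁅η, η'⁆ ξ = tr η (tr η' ξ) - tr η' (tr η ξ))
    (h_right : ∀ (η : H) (ξ ξ' : G), tl η ⁅ξ, ξ'⁆ = tl (tl η ξ) ξ' - tl (tl η ξ') ξ)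
    (hM1 : ∀ (η η' : H) (ξ : G),
      tl ⁅η, η'⁆ ξ = ⁅η, tl η' ξ⁆ - ⁅η', tl η ξ⁆ + tl η (tr η' ξ) - tl η' (tr η ξ))
    (hM2 : ∀ (η : H) (ξ ξ' : G),
      tr η ⁅ξ, ξ'⁆ = ⁅ξ, tr η ξ'⁆ - ⁅ξ', tr η ξ⁆ + tr (tl η ξ) ξ' - tr (tl η ξ') ξ) :
    IsLieBracketOn 𝕜 (M := G × H) (fun x y =>
      (⁅x.1, y.1⁆ + tr x.2 y.1 - tr y.2 x.1,
        ⁅x.2, y.2⁆ + tl x.2 y.1 - tl y.2 x.1)) := by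
  refine ⟨fun a x y z => ?_, fun a x y z => ?_, fun x => ?_, fun x y z => ?_⟩
  · ext <;> simp [smul_add, smul_sub] <;> abel
  · ext <;> simp [smul_add, smul_sub] <;> abel
  · ext <;> simp
  · ext
    · have jacobi := lie_jacobi x.1 y.1 z.1
      simp only [Prod.fst_add, Prod.fst_zero, lie_add, lie_sub, map_add, map_sub,
        LinearMap.add_apply, LinearMap.sub_apply, h_left, hM2]
      rw [← jacobi]
      abel
    · have jacobi := lie_jacobi x.2 y.2 z.2
      simp only [Prod.snd_add, Prod.snd_zero, lie_add, lie_sub, map_add, map_sub,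
        LinearMap.add_apply, LinearMap.sub_apply, h_right, hM1]
      rw [← jacobi]
      abel
end

section
/- Under the stated hypotheses, the map ⊡▷ : (𝔩⋈𝔨) × (V⊕W) → V⊕W, (l,k)⊡▷(v,w) := (l↓v + k↷v, −w↶l + k⇂w), is a left Lie-algebra action of the matched pair Lie algebra 𝔩⋈𝔨 on V⊕W; the map Θ((l,k),(l′,k′)) := (φ(l,l′) + ε(k,l′) − ε(k′,l), ψ(k,k′) + ι(k,l′) − ι(k′,l)) is alternating and satisfies the 2-cocycle identity with respect to the bracket of 𝔩⋈𝔨 and the action ⊡▷; and the linear reordering map ((v,l),(w,k)) ↦ ((v,w),(l,k)) is an isomorphism of Lie algebras from the matched pair 𝔤 ⋈ 𝔥 = (V ⋊_φ 𝔩) ⋈ (W ⋊_ψ 𝔨) onto the 2-cocycle extension (V⊕W) ⋊_Θ (𝔩⋈𝔨), whose bracket is [((v,w),(l,k)),((v′,w′),(l′,k′))] = ((l,k)⊡▷(v′,w′) − (l′,k′)⊡▷(v,w) + Θ((l,k),(l′,k′)), [(l,k),(l′,k′)]_{𝔩⋈𝔨}). -/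
section

variable {𝕜 L K' V W : Type*} [Field 𝕜]
  [LieRing L] [LieAlgebra 𝕜 L] [LieRing K'] [LieAlgebra 𝕜 K']
  [AddCommGroup V] [Module 𝕜 V] [AddCommGroup W] [Module 𝕜 W]

/-- The 2-cocycle extension bracket on `V × L` (resp. `W × K'`):
`[(v,l),(v′,l′)] = (l↓v′ − l′↓v + φ(l,l′), [l,l′])`. -/
def cocExtBracket (da : L →ₗ[𝕜] V →ₗ[𝕜] V) (φ : L →ₗ[𝕜] L →ₗ[𝕜] V)
    (x y : V × L) : V × L :=
  (da x.2 y.1 - da y.2 x.1 + φ x.2 y.2, ⁅x.2, y.2⁆)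

/-- The matched pair bracket on `L × K'` built from `▶ = br` and `◀ = bl`. -/
def mpLKBracket (br : K' →ₗ[𝕜] L →ₗ[𝕜] L) (bl : K' →ₗ[𝕜] L →ₗ[𝕜] K')
    (x y : L × K') : L × K' :=
  (⁅x.1, y.1⁆ + br x.2 y.1 - br y.2 x.1, ⁅x.2, y.2⁆ + bl x.2 y.1 - bl y.2 x.1)

/-- The map `⊡▷ : (L⋈K') × (V⊕W) → V⊕W`,
`(l,k)⊡▷(v,w) = (l↓v + k↷v, −w↶l + k⇂w)`. -/
def boxAct (da : L →ₗ[𝕜] V →ₗ[𝕜] V) (c : K' →ₗ[𝕜] V →ₗ[𝕜] V)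
    (ca : W →ₗ[𝕜] L →ₗ[𝕜] W) (db : K' →ₗ[𝕜] W →ₗ[𝕜] W)
    (x : L × K') (u : V × W) : V × W :=
  (da x.1 u.1 + c x.2 u.1, -(ca u.2 x.1) + db x.2 u.2)

/-- `Θ((l,k),(l′,k′)) = (φ(l,l′) + ε(k,l′) − ε(k′,l), ψ(k,k′) + ι(k,l′) − ι(k′,l))`. -/
def thetaCocycle (φ : L →ₗ[𝕜] L →ₗ[𝕜] V) (ψ : K' →ₗ[𝕜] K' →ₗ[𝕜] W)
    (ε : K' →ₗ[𝕜] L →ₗ[𝕜] V) (ι : K' →ₗ[𝕜] L →ₗ[𝕜] W)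
    (x y : L × K') : V × W :=
  (φ x.1 y.1 + ε x.2 y.1 - ε y.2 x.1, ψ x.2 y.2 + ι x.2 y.1 - ι y.2 x.1)

/-- `▷ : 𝔥 × 𝔤 → 𝔤`, `(w,k)▷(v,l) = (k↷v + ε(k,l), k▶l)`. -/
def actR (c : K' →ₗ[𝕜] V →ₗ[𝕜] V) (ε : K' →ₗ[𝕜] L →ₗ[𝕜] V)
    (br : K' →ₗ[𝕜] L →ₗ[𝕜] L) (η : W × K') (ξ : V × L) : V × L :=
  (c η.2 ξ.1 + ε η.2 ξ.2, br η.2 ξ.2)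

/-- `◁ : 𝔥 × 𝔤 → 𝔥`, `(w,k)◁(v,l) = (w↶l + ι(k,l), k◀l)`. -/
def actL (ca : W →ₗ[𝕜] L →ₗ[𝕜] W) (ι : K' →ₗ[𝕜] L →ₗ[𝕜] W)
    (bl : K' →ₗ[𝕜] L →ₗ[𝕜] K') (η : W × K') (ξ : V × L) : W × K' :=
  (ca η.1 ξ.2 + ι η.2 ξ.2, bl η.2 ξ.2)

/-- The matched pair bracket on `𝔤 × 𝔥 = (V × L) × (W × K')`. -/
def mpGHBracket (da : L →ₗ[𝕜] V →ₗ[𝕜] V) (φ : L →ₗ[𝕜] L →ₗ[𝕜] V)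
    (db : K' →ₗ[𝕜] W →ₗ[𝕜] W) (ψ : K' →ₗ[𝕜] K' →ₗ[𝕜] W)
    (c : K' →ₗ[𝕜] V →ₗ[𝕜] V) (ca : W →ₗ[𝕜] L →ₗ[𝕜] W)
    (ε : K' →ₗ[𝕜] L →ₗ[𝕜] V) (ι : K' →ₗ[𝕜] L →ₗ[𝕜] W)
    (br : K' →ₗ[𝕜] L →ₗ[𝕜] L) (bl : K' →ₗ[𝕜] L →ₗ[𝕜] K')
    (a b : (V × L) × (W × K')) : (V × L) × (W × K') :=
  (cocExtBracket da φ a.1 b.1 + actR c ε br a.2 b.1 - actR c ε br b.2 a.1,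
    cocExtBracket db ψ a.2 b.2 + actL ca ι bl a.2 b.1 - actL ca ι bl b.2 a.1)

/-- The 2-cocycle extension bracket on `(V × W) × (L × K')` built from
the action `⊡▷` and the cocycle `Θ`. -/
def thetaExtBracket (da : L →ₗ[𝕜] V →ₗ[𝕜] V) (φ : L →ₗ[𝕜] L →ₗ[𝕜] V)
    (db : K' →ₗ[𝕜] W →ₗ[𝕜] W) (ψ : K' →ₗ[𝕜] K' →ₗ[𝕜] W)
    (c : K' →ₗ[𝕜] V →ₗ[𝕜] V) (ca : W →ₗ[𝕜] L →ₗ[𝕜] W)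
    (ε : K' →ₗ[𝕜] L →ₗ[𝕜] V) (ι : K' →ₗ[𝕜] L →ₗ[𝕜] W)
    (br : K' →ₗ[𝕜] L →ₗ[𝕜] L) (bl : K' →ₗ[𝕜] L →ₗ[𝕜] K')
    (u u' : (V × W) × (L × K')) : (V × W) × (L × K') :=
  (boxAct da c ca db u.2 u'.1 - boxAct da c ca db u'.2 u.1
      + thetaCocycle φ ψ ε ι u.2 u'.2,
    mpLKBracket br bl u.2 u'.2)

/-- Under the stated hypotheses, `⊡▷` is a left Lie-algebra
action of `L⋈K'` on `V⊕W`, `Θ` is an alternating 2-cocycle with respect to the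
bracket of `L⋈K'` and the action `⊡▷`, and the reordering map
`((v,l),(w,k)) ↦ ((v,w),(l,k))` is a Lie algebra isomorphism from
`(V ⋊_φ L) ⋈ (W ⋊_ψ K')` onto `(V⊕W) ⋊_Θ (L⋈K')`. -/
theorem matchedPair_of_cocycle_extensions_is_cocycle_extension
    (da : L →ₗ[𝕜] V →ₗ[𝕜] V) (db : K' →ₗ[𝕜] W →ₗ[𝕜] W)
    (φ : L →ₗ[𝕜] L →ₗ[𝕜] V) (ψ : K' →ₗ[𝕜] K' →ₗ[𝕜] W)
    (br : K' →ₗ[𝕜] L →ₗ[𝕜] L) (bl : K' →ₗ[𝕜] L →ₗ[𝕜] K')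
    (c : K' →ₗ[𝕜] V →ₗ[𝕜] V) (ca : W →ₗ[𝕜] L →ₗ[𝕜] W)
    (ε : K' →ₗ[𝕜] L →ₗ[𝕜] V) (ι : K' →ₗ[𝕜] L →ₗ[𝕜] W)
    -- ↓ and ⇂ are left Lie-algebra actions
    (hda : ∀ (l l' : L) (v : V), da ⁅l, l'⁆ v = da l (da l' v) - da l' (da l v))
    (hdb : ∀ (k k' : K') (w : W), db ⁅k, k'⁆ w = db k (db k' w) - db k' (db k w))
    -- φ and ψ are alternating 2-cocycles
    (hφalt : ∀ l : L, φ l l = 0)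
    (hφcoc : ∀ l l' l'' : L,
      φ l ⁅l', l''⁆ + φ l' ⁅l'', l⁆ + φ l'' ⁅l, l'⁆
        + da l (φ l' l'') + da l' (φ l'' l) + da l'' (φ l l') = 0)
    (hψalt : ∀ k : K', ψ k k = 0)
    (hψcoc : ∀ k k' k'' : K',
      ψ k ⁅k', k''⁆ + ψ k' ⁅k'', k⁆ + ψ k'' ⁅k, k'⁆
        + db k (ψ k' k'') + db k' (ψ k'' k) + db k'' (ψ k k') = 0)
    -- ▶ is a left action, ◀ a right action, and (L, K') is a matched pair
    (hbr : ∀ (k k' : K') (l : L), br ⁅k, k'⁆ l = br k (br k' l) - br k' (br k l))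
    (hbl : ∀ (k : K') (l l' : L), bl k ⁅l, l'⁆ = bl (bl k l) l' - bl (bl k l') l)
    (hM1lk : ∀ (k k' : K') (l : L),
      bl ⁅k, k'⁆ l = ⁅k, bl k' l⁆ - ⁅k', bl k l⁆ + bl k (br k' l) - bl k' (br k l))
    (hM2lk : ∀ (k : K') (l l' : L),
      br k ⁅l, l'⁆ = ⁅l, br k l'⁆ - ⁅l', br k l⁆ + br (bl k l) l' - br (bl k l') l)
    -- ↷ is a left action and ↶ a right action
    (hc : ∀ (k k' : K') (v : V), c ⁅k, k'⁆ v = c k (c k' v) - c k' (c k v))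
    (hca : ∀ (w : W) (l l' : L), ca w ⁅l, l'⁆ = ca (ca w l) l' - ca (ca w l') l)
    -- ▷ is a left Lie-algebra action of 𝔥 on 𝔤
    (hactR : ∀ (η η' : W × K') (ξ : V × L),
      actR c ε br (cocExtBracket db ψ η η') ξ
        = actR c ε br η (actR c ε br η' ξ) - actR c ε br η' (actR c ε br η ξ))
    -- ◁ is a right Lie-algebra action of 𝔤 on 𝔥
    (hactL : ∀ (η : W × K') (ξ ξ' : V × L),
      actL ca ι bl η (cocExtBracket da φ ξ ξ')
        = actL ca ι bl (actL ca ι bl η ξ) ξ' - actL ca ι bl (actL ca ι bl η ξ') ξ)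
    -- (M1) and (M2) for (𝔤, 𝔥, ▷, ◁)
    (hM1 : ∀ (η η' : W × K') (ξ : V × L),
      actL ca ι bl (cocExtBracket db ψ η η') ξ
        = cocExtBracket db ψ η (actL ca ι bl η' ξ)
          - cocExtBracket db ψ η' (actL ca ι bl η ξ)
          + actL ca ι bl η (actR c ε br η' ξ) - actL ca ι bl η' (actR c ε br η ξ))
    (hM2 : ∀ (η : W × K') (ξ ξ' : V × L),
      actR c ε br η (cocExtBracket da φ ξ ξ')
        = cocExtBracket da φ ξ (actR c ε br η ξ')
          - cocExtBracket da φ ξ' (actR c ε br η ξ)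
          + actR c ε br (actL ca ι bl η ξ) ξ' - actR c ε br (actL ca ι bl η ξ') ξ) :
    -- (a) ⊡▷ is a left Lie-algebra action of L⋈K' on V⊕W
    (∀ (x y : L × K') (u : V × W),
      boxAct da c ca db (mpLKBracket br bl x y) u
        = boxAct da c ca db x (boxAct da c ca db y u)
          - boxAct da c ca db y (boxAct da c ca db x u)) ∧
    -- (b) Θ is alternating and a 2-cocycle w.r.t. the bracket of L⋈K' and ⊡▷
    (∀ x : L × K', thetaCocycle φ ψ ε ι x x = 0) ∧
    (∀ x y z : L × K',
      thetaCocycle φ ψ ε ι x (mpLKBracket br bl y z)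
        + thetaCocycle φ ψ ε ι y (mpLKBracket br bl z x)
        + thetaCocycle φ ψ ε ι z (mpLKBracket br bl x y)
        + boxAct da c ca db x (thetaCocycle φ ψ ε ι y z)
        + boxAct da c ca db y (thetaCocycle φ ψ ε ι z x)
        + boxAct da c ca db z (thetaCocycle φ ψ ε ι x y) = 0) ∧
    -- (c) the reordering map is a Lie algebra isomorphism
    (IsLinearMap 𝕜 (fun a : (V × L) × (W × K') =>
        (((a.1.1, a.2.1), (a.1.2, a.2.2)) : (V × W) × (L × K')))) ∧
    (Function.Bijective (fun a : (V × L) × (W × K') =>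
        (((a.1.1, a.2.1), (a.1.2, a.2.2)) : (V × W) × (L × K')))) ∧
    (∀ a b : (V × L) × (W × K'),
      (fun a : (V × L) × (W × K') =>
          (((a.1.1, a.2.1), (a.1.2, a.2.2)) : (V × W) × (L × K')))
        (mpGHBracket da φ db ψ c ca ε ι br bl a b)
        = thetaExtBracket da φ db ψ c ca ε ι br bl
            ((fun a : (V × L) × (W × K') =>
              (((a.1.1, a.2.1), (a.1.2, a.2.2)) : (V × W) × (L × K'))) a)
            ((fun a : (V × L) × (W × K') =>
              (((a.1.1, a.2.1), (a.1.2, a.2.2)) : (V × W) × (L × K'))) b)) := by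
  have hε (k k' : K') (l : L) : ε ⁅k, k'⁆ l
      = c k (ε k' l) + ε k (br k' l) - (c k' (ε k l) + ε k' (br k l)) := by
    simpa [actR, cocExtBracket] using congrArg Prod.fst (hactR (0, k) (0, k') (0, l))
  have hι (k : K') (l l' : L) : ι k ⁅l, l'⁆
      = ca (ι k l) l' + ι (bl k l) l' - (ca (ι k l') l + ι (bl k l') l) := by
    simpa [actL, cocExtBracket] using congrArg Prod.fst (hactL (0, k) (0, l) (0, l'))
  have hcadb (k : K') (w : W) (l : L) :
      ca (db k w) l = db k (ca w l) + db (bl k l) w - ca w (br k l) := by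
    have h := congrArg Prod.fst (hM1 (0, k) (w, 0) (0, l))
    simp [actL, actR, cocExtBracket] at h
    rw [h]
  have hcda (k : K') (l : L) (v : V) :
      c k (da l v) = da l (c k v) + da (br k l) v + c (bl k l) v := by
    have h := congrArg Prod.fst (hM2 (0, k) (0, l) (v, 0))
    simp [actL, actR, cocExtBracket] at h
    rw [h]
  have hψι (k k' : K') (l : L) : ca (ψ k k') l + ι ⁅k, k'⁆ l
      = db k (ι k' l) + ψ k (bl k' l) - (db k' (ι k l) + ψ k' (bl k l))
        + ι k (br k' l) - ι k' (br k l) := by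
    simpa [actL, actR, cocExtBracket] using congrArg Prod.fst (hM1 (0, k) (0, k') (0, l))
  have hφε (k : K') (l l' : L) : c k (φ l l') + ε k ⁅l, l'⁆
      = da l (ε k l') + φ l (br k l') - (da l' (ε k l) + φ l' (br k l))
        + ε (bl k l) l' - ε (bl k l') l := by
    simpa [actL, actR, cocExtBracket] using congrArg Prod.fst (hM2 (0, k) (0, l) (0, l'))
  refine ⟨?_, ?_, ?_, ⟨fun _ _ => rfl, fun _ _ => rfl⟩, ⟨?_, ?_⟩, ?_⟩
  · rintro ⟨l, k⟩ ⟨l', k'⟩ ⟨v, w⟩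
    ext
    · simp only [boxAct, mpLKBracket, map_add, map_sub, LinearMap.add_apply,
        LinearMap.sub_apply, Prod.fst_sub, hda, hc, hcda]
      abel
    · simp only [boxAct, mpLKBracket, map_add, map_sub, map_neg, LinearMap.add_apply,
        LinearMap.sub_apply, LinearMap.neg_apply, Prod.snd_sub, hdb, hca, hcadb]
      abel
  · rintro ⟨l, k⟩
    simp [thetaCocycle, hφalt, hψalt]
  · rintro ⟨l₁, k₁⟩ ⟨l₂, k₂⟩ ⟨l₃, k₃⟩
    ext
    · simp only [boxAct, mpLKBracket, thetaCocycle, map_add, map_sub, LinearMap.add_apply,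
        LinearMap.sub_apply, Prod.fst_add, Prod.fst_zero]
      linear_combination (norm := abel) hφcoc l₁ l₂ l₃
        + hφε k₁ l₂ l₃ + hφε k₂ l₃ l₁ + hφε k₃ l₁ l₂
        - hε k₂ k₃ l₁ - hε k₃ k₁ l₂ - hε k₁ k₂ l₃
    · simp only [boxAct, mpLKBracket, thetaCocycle, map_add, map_sub, LinearMap.add_apply,
        LinearMap.sub_apply, Prod.snd_add, Prod.snd_zero]
      linear_combination (norm := abel) hψcoc k₁ k₂ k₃
        - hψι k₂ k₃ l₁ - hψι k₃ k₁ l₂ - hψι k₁ k₂ l₃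
        + hι k₁ l₂ l₃ + hι k₂ l₃ l₁ + hι k₃ l₁ l₂
  · rintro ⟨⟨v, l⟩, ⟨w, k⟩⟩ ⟨⟨v', l'⟩, ⟨w', k'⟩⟩ h
    simp_all
  · rintro ⟨⟨v, w⟩, ⟨l, k⟩⟩
    exact ⟨((v, l), (w, k)), rfl⟩
  · rintro ⟨⟨v, l⟩, ⟨w, k⟩⟩ ⟨⟨v', l'⟩, ⟨w', k'⟩⟩
    simp only [mpGHBracket, thetaExtBracket, cocExtBracket, actR, actL, boxAct, thetaCocycle,
      mpLKBracket, Prod.mk_add_mk, Prod.mk_sub_mk, Prod.mk.injEq, and_true]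
    constructor <;> abel

end
end

section
/- Let 𝔩⋈𝔨 be a matched pair Lie algebra, let ↓ : 𝔩 × V → V and ⇂ : 𝔨 × W → W be left Lie-algebra actions, let ↷ : 𝔨 × V → V be a left Lie-algebra action and ↶ : W × 𝔩 → W a right Lie-algebra action. Then the map ⊡▷ : (𝔩⋈𝔨) × (V⊕W) → V⊕W, (l,k)⊡▷(v,w) := (l↓v + k↷v, −w↶l + k⇂w), is a left Lie-algebra action of 𝔩⋈𝔨 on V⊕W if and only if for all l,l′ ∈ 𝔩, k,k′ ∈ 𝔨, v ∈ V, w ∈ W: (k▶l′)↓v − (k′▶l)↓v + (k◀l′)↷v − (k′◀l)↷v = l↓(k′↷v) − l′↓(k↷v) + k↷(l′↓v) − k′↷(l↓v), and −w↶(k▶l′) + w↶(k′▶l) + (k◀l′)⇂w − (k′◀l)⇂w = −(k′⇂w)↶l + (k⇂w)↶l′ − k⇂(w↶l′) + k′⇂(w↶l). -/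
section

variable {𝕜 L K' V W : Type*} [Field 𝕜]
  [LieRing L] [LieAlgebra 𝕜 L] [LieRing K'] [LieAlgebra 𝕜 K']
  [AddCommGroup V] [Module 𝕜 V] [AddCommGroup W] [Module 𝕜 W]

/-- `⊡▷` is a left Lie-algebra action of the matched pair
Lie algebra `L⋈K'` on `V⊕W` iff the two displayed compatibility conditions hold. -/
theorem boxAct_leftAction_iff
    (br : K' →ₗ[𝕜] L →ₗ[𝕜] L) (bl : K' →ₗ[𝕜] L →ₗ[𝕜] K')
    (hbr : ∀ (k k' : K') (l : L), br ⁅k, k'⁆ l = br k (br k' l) - br k' (br k l))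
    (hbl : ∀ (k : K') (l l' : L), bl k ⁅l, l'⁆ = bl (bl k l) l' - bl (bl k l') l)
    (hM1lk : ∀ (k k' : K') (l : L),
      bl ⁅k, k'⁆ l = ⁅k, bl k' l⁆ - ⁅k', bl k l⁆ + bl k (br k' l) - bl k' (br k l))
    (hM2lk : ∀ (k : K') (l l' : L),
      br k ⁅l, l'⁆ = ⁅l, br k l'⁆ - ⁅l', br k l⁆ + br (bl k l) l' - br (bl k l') l)
    (da : L →ₗ[𝕜] V →ₗ[𝕜] V) (db : K' →ₗ[𝕜] W →ₗ[𝕜] W)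
    (c : K' →ₗ[𝕜] V →ₗ[𝕜] V) (ca : W →ₗ[𝕜] L →ₗ[𝕜] W)
    (hda : ∀ (l l' : L) (v : V), da ⁅l, l'⁆ v = da l (da l' v) - da l' (da l v))
    (hdb : ∀ (k k' : K') (w : W), db ⁅k, k'⁆ w = db k (db k' w) - db k' (db k w))
    (hc : ∀ (k k' : K') (v : V), c ⁅k, k'⁆ v = c k (c k' v) - c k' (c k v))
    (hca : ∀ (w : W) (l l' : L), ca w ⁅l, l'⁆ = ca (ca w l) l' - ca (ca w l') l) :
    (∀ (x y : L × K') (u : V × W),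
      boxAct da c ca db (mpLKBracket br bl x y) u
        = boxAct da c ca db x (boxAct da c ca db y u)
          - boxAct da c ca db y (boxAct da c ca db x u)) ↔
    ((∀ (l l' : L) (k k' : K') (v : V),
        da (br k l') v - da (br k' l) v + c (bl k l') v - c (bl k' l) v
          = da l (c k' v) - da l' (c k v) + c k (da l' v) - c k' (da l v)) ∧
      (∀ (l l' : L) (k k' : K') (w : W),
        -(ca w (br k l')) + ca w (br k' l) + db (bl k l') w - db (bl k' l) w
          = -(ca (db k' w) l) + ca (db k w) l' - db k (ca w l') + db k' (ca w l))) := by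
  have key (l l' : L) (k k' : K') (v : V) (w : W) :
      boxAct da c ca db (mpLKBracket br bl (l, k) (l', k')) (v, w)
          = boxAct da c ca db (l, k) (boxAct da c ca db (l', k') (v, w))
            - boxAct da c ca db (l', k') (boxAct da c ca db (l, k) (v, w)) ↔
        (da (br k l') v - da (br k' l) v + c (bl k l') v - c (bl k' l) v
          = da l (c k' v) - da l' (c k v) + c k (da l' v) - c k' (da l v)) ∧
        (-(ca w (br k l')) + ca w (br k' l) + db (bl k l') w - db (bl k' l) w
          = -(ca (db k' w) l) + ca (db k w) l' - db k (ca w l') + db k' (ca w l)) := by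
    simp only [boxAct, mpLKBracket, Prod.ext_iff, Prod.fst_sub, Prod.snd_sub, map_add, map_sub,
      map_neg, LinearMap.add_apply, LinearMap.sub_apply, LinearMap.neg_apply, hda, hdb, hc, hca]
    refine and_congr ?_ ?_ <;>
      exact ⟨fun h => by linear_combination (norm := abel) h,
        fun h => by linear_combination (norm := abel) h⟩
  constructor
  · intro h
    exact ⟨fun l l' k k' v => ((key l l' k k' v 0).1 (h _ _ _)).1,
      fun l l' k k' w => ((key l l' k k' 0 w).1 (h _ _ _)).2⟩
  · rintro ⟨hV, hW⟩ ⟨l, k⟩ ⟨l', k'⟩ ⟨v, w⟩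
    exact (key l l' k k' v w).2 ⟨hV l l' k k' v, hW l l' k k' w⟩

end
end

section
/- Let k := (0,0,1) ∈ ℝ³ and let × denote the cross product on ℝ³. The bracket [η,η′] := k × (η × η′) is bilinear, alternating, and satisfies the Jacobi identity, making ℝ³ a real Lie algebra. -/
open Matrix

/-- With `k = (0,0,1)` and `×` the cross product on `ℝ³`,
the bracket `[η,η′] := k × (η × η′)` makes `ℝ³` a real Lie algebra. -/
theorem k_cross_bracket_isLieBracket :
    IsLieBracketOn ℝ (fun η η' : Fin 3 → ℝ =>
      crossProduct (![0, 0, 1] : Fin 3 → ℝ) (crossProduct η η')) := by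
  refine ⟨fun a x y z => by simp, fun a x y z => by simp, fun x => by simp, fun x y z => ?_⟩
  ext i
  fin_cases i <;> simp [cross_apply] <;> ring
end

section
/- Let k := (0,0,1) ∈ ℝ³ and let × denote the cross product. Define on ℝ³ × ℝ³ the bracket [(ξ,η),(ξ′,η′)] := (ξ×ξ′ + η×(ξ′×k) − η′×(ξ×k), k×(η×η′) + η×ξ′ − η′×ξ). This bracket is bilinear, alternating, and satisfies the Jacobi identity, making ℝ³ × ℝ³ ≅ ℝ⁶ a real Lie algebra. -/
open Matrix

/-- With `k = (0,0,1)` and `×` the cross product, the bracket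
`[(ξ,η),(ξ′,η′)] := (ξ×ξ′ + η×(ξ′×k) − η′×(ξ×k), k×(η×η′) + η×ξ′ − η′×ξ)`
makes `ℝ³ × ℝ³ ≅ ℝ⁶` a real Lie algebra. -/
theorem rigidBody_matchedPair_isLieBracket :
    IsLieBracketOn ℝ (fun x y : (Fin 3 → ℝ) × (Fin 3 → ℝ) =>
      ((crossProduct x.1 y.1
          + crossProduct x.2 (crossProduct y.1 (![0, 0, 1] : Fin 3 → ℝ))
          - crossProduct y.2 (crossProduct x.1 (![0, 0, 1] : Fin 3 → ℝ)),
        crossProduct (![0, 0, 1] : Fin 3 → ℝ) (crossProduct x.2 y.2)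
          + crossProduct x.2 y.1 - crossProduct y.2 x.1) :
        (Fin 3 → ℝ) × (Fin 3 → ℝ))) := by
  refine ⟨fun a x y z => ?_, fun a x y z => ?_, fun x => ?_, fun x y z => ?_⟩
  · ext i <;> fin_cases i <;> simp [cross_apply] <;> ring
  · ext i <;> fin_cases i <;> simp [cross_apply] <;> ring
  · ext i <;> simp
  · ext i <;> fin_cases i <;> simp [cross_apply] <;> ring
end

section
/- Let k := (0,0,1) ∈ ℝ³, let 𝔤 = ℝ³ with the cross-product bracket [ξ,ξ′] = ξ×ξ′, and let 𝔥 = ℝ³ with the bracket [η,η′] = k×(η×η′). Then the maps η▷ξ := η×(ξ×k) and η◁ξ := η×ξ satisfy, for all ξ,ξ′,η,η′ ∈ ℝ³: (i) (k×(η×η′))×(ξ×k) = η×((η′×(ξ×k))×k) − η′×((η×(ξ×k))×k), i.e., ▷ is a left Lie-algebra action of 𝔥 on 𝔤; (ii) η×(ξ×ξ′) = (η×ξ)×ξ′ − (η×ξ′)×ξ, i.e., ◁ is a right Lie-algebra action of 𝔤 on 𝔥; (iii) the matched pair condition (M1): (k×(η×η′))×ξ = k×(η×(η′×ξ)) − k×(η′×(η×ξ))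 + η×(η′×(ξ×k)) − η′×(η×(ξ×k)); (iv) the matched pair condition (M2): η×((ξ×ξ′)×k) = ξ×(η×(ξ′×k)) − ξ′×(η×(ξ×k)) + (η×ξ)×(ξ′×k) − (η×ξ′)×(ξ×k). -/
open Matrix

local notation "k₃" => (![0, 0, 1] : Fin 3 → ℝ)

/-- For `𝔤 = ℝ³` with the cross-product bracket and
`𝔥 = ℝ³` with the bracket `[η,η′] = k×(η×η′)`, the maps `η▷ξ := η×(ξ×k)` and
`η◁ξ := η×ξ` form mutual actions satisfying the matched pair conditions. -/
theorem rigidBody_matchedPair_actions :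
    -- (i) ▷ is a left Lie-algebra action of 𝔥 on 𝔤
    (∀ ξ η η' : Fin 3 → ℝ,
      crossProduct (crossProduct k₃ (crossProduct η η')) (crossProduct ξ k₃)
        = crossProduct η (crossProduct (crossProduct η' (crossProduct ξ k₃)) k₃)
          - crossProduct η' (crossProduct (crossProduct η (crossProduct ξ k₃)) k₃)) ∧
    -- (ii) ◁ is a right Lie-algebra action of 𝔤 on 𝔥
    (∀ ξ ξ' η : Fin 3 → ℝ,
      crossProduct η (crossProduct ξ ξ')
        = crossProduct (crossProduct η ξ) ξ' - crossProduct (crossProduct η ξ') ξ) ∧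
    -- (iii) the matched pair condition (M1)
    (∀ ξ η η' : Fin 3 → ℝ,
      crossProduct (crossProduct k₃ (crossProduct η η')) ξ
        = crossProduct k₃ (crossProduct η (crossProduct η' ξ))
          - crossProduct k₃ (crossProduct η' (crossProduct η ξ))
          + crossProduct η (crossProduct η' (crossProduct ξ k₃))
          - crossProduct η' (crossProduct η (crossProduct ξ k₃))) ∧
    -- (iv) the matched pair condition (M2)
    (∀ ξ ξ' η : Fin 3 → ℝ,
      crossProduct η (crossProduct (crossProduct ξ ξ') k₃)
        = crossProduct ξ (crossProduct η (crossProduct ξ' k₃))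
          - crossProduct ξ' (crossProduct η (crossProduct ξ k₃))
          + crossProduct (crossProduct η ξ) (crossProduct ξ' k₃)
          - crossProduct (crossProduct η ξ') (crossProduct ξ k₃)) := by
  refine ⟨?_, ?_, ?_, ?_⟩ <;> intro u v w <;> ext i <;> fin_cases i <;>
    simp [cross_apply] <;> ring
end
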